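/- Let G and H be connected graphs, let M be a nonempty proper module of G, and let G' be the graph obtained from G by replacing G[M] with H. Suppose the longest induced path of G has at least 4 vertices, and the number of vertices of a longest induced path of G[M] equals the number of vertices of a longest induced path of H. Then the number of vertices of a longest induced path of G is at most the number of vertices of a longest induced path of G'. -/

import Mathlib

open SimpleGraph Set

/-- `M` is a module of `G`: every vertex outside `M` is adjacent to all of `M`
or to none of `M`. -/
def SimpleGraph.IsModuleSet {V : Type*} (G : SimpleGraph V) (M : Set V) : Prop :=
  ∀ v ∉ M, (∀ m ∈ M, G.Adj v m) ∨ (∀ m ∈ M, ¬ G.Adj v m)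

/-- The graph obtained from `G` by replacing `G[M]` with `H`: its vertices are
`(V ∖ M) ⊕ V(H)`, with the edges of `G` outside `M`, the edges of `H`, and all
edges between `N_G(M) ∖ M` and `V(H)`. -/
def modularReplacement {V W : Type*} (G : SimpleGraph V) (M : Set V)
    (H : SimpleGraph W) : SimpleGraph ({v : V // v ∉ M} ⊕ W) :=
  SimpleGraph.fromRel (fun x y =>
    match x, y with
    | Sum.inl u, Sum.inl v => G.Adj u.1 v.1
    | Sum.inl u, Sum.inr _ => ∃ m ∈ M, G.Adj u.1 m
    | Sum.inr _, Sum.inl _ => False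
    | Sum.inr u, Sum.inr v => H.Adj u v)

section Invariants

variable {V : Type*} (G : SimpleGraph V)

/-- A dominating set. -/
def IsDomSet (D : Set V) : Prop := ∀ v ∉ D, ∃ u ∈ D, G.Adj v u

/-- A minimum dominating set. -/
def IsMinDomSet (D : Set V) : Prop :=
  IsDomSet G D ∧ ∀ D', IsDomSet G D' → D.ncard ≤ D'.ncard

/-- The domination number. -/
noncomputable def domNum : ℕ := sInf {n | ∃ D, IsDomSet G D ∧ D.ncard = n}

/-- A vertex cover. -/
def IsVCover (C : Set V) : Prop := ∀ ⦃u v⦄, G.Adj u v → u ∈ C ∨ v ∈ C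

/-- A minimum vertex cover. -/
def IsMinVCover (C : Set V) : Prop :=
  IsVCover G C ∧ ∀ C', IsVCover G C' → C.ncard ≤ C'.ncard

/-- The vertex cover number. -/
noncomputable def vcNum : ℕ := sInf {n | ∃ C, IsVCover G C ∧ C.ncard = n}

/-- A connected vertex cover. -/
def IsCVCover (C : Set V) : Prop := IsVCover G C ∧ (G.induce C).Connected

/-- A minimum connected vertex cover. -/
def IsMinCVCover (C : Set V) : Prop :=
  IsCVCover G C ∧ ∀ C', IsCVCover G C' → C.ncard ≤ C'.ncard

/-- The connected vertex cover number. -/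
noncomputable def cvcNum : ℕ := sInf {n | ∃ C, IsCVCover G C ∧ C.ncard = n}

/-- A feedback vertex set: its removal leaves an acyclic graph. -/
def IsFVS (S : Set V) : Prop := (G.induce Sᶜ).IsAcyclic

/-- A minimum feedback vertex set. -/
def IsMinFVS (S : Set V) : Prop :=
  IsFVS G S ∧ ∀ S', IsFVS G S' → S.ncard ≤ S'.ncard

/-- The feedback vertex set number. -/
noncomputable def fvsNum : ℕ := sInf {n | ∃ S, IsFVS G S ∧ S.ncard = n}

/-- An odd cycle transversal: its removal leaves a bipartite graph. -/
def IsOCT (S : Set V) : Prop := (G.induce Sᶜ).Colorable 2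

/-- A minimum odd cycle transversal. -/
def IsMinOCT (S : Set V) : Prop :=
  IsOCT G S ∧ ∀ S', IsOCT G S' → S.ncard ≤ S'.ncard

/-- The odd cycle transversal number. -/
noncomputable def octNum : ℕ := sInf {n | ∃ S, IsOCT G S ∧ S.ncard = n}

/-- An independent set: pairwise non-adjacent vertices. -/
def IsIndepSet' (I : Set V) : Prop := I.Pairwise (fun u v => ¬ G.Adj u v)

/-- A partition of `G` into `k` (vertex-disjoint) paths covering all vertices. -/
def IsPathPartition (k : ℕ) (P : Fin k → (u : V) × (v : V) × G.Walk u v) : Prop :=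
  (∀ i, (P i).2.2.IsPath) ∧
  (∀ i j, i ≠ j → ∀ x, x ∈ (P i).2.2.support → x ∉ (P j).2.2.support) ∧
  (∀ x : V, ∃ i, x ∈ (P i).2.2.support)

/-- The minimum number of paths in a partition of `G` into paths. -/
noncomputable def pathPartitionNum : ℕ :=
  sInf {k | ∃ P : Fin k → (u : V) × (v : V) × G.Walk u v, IsPathPartition G k P}

/-- `G` has a Hamiltonian cycle. -/
def HasHamCycle : Prop := ∃ (v : V) (p : G.Walk v v), p.IsCycle ∧ ∀ u : V, u ∈ p.support

/-- The number of vertices of a longest induced path of `G`. -/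
noncomputable def lipNum : ℕ :=
  sSup {n | ∃ S : Set V, Nonempty (G.induce S ≃g pathGraph n)}

/-- `X` is an induced matching with `k` edges: `X` has `2k` vertices and the
subgraph induced by `X` is `1`-regular. -/
def IsInducedMatching (X : Set V) (k : ℕ) : Prop :=
  X.ncard = 2 * k ∧ ∀ v ∈ X, ∃! u, u ∈ X ∧ G.Adj v u

/-- The maximum number of edges of an induced matching of `G`. -/
noncomputable def imNum : ℕ := sSup {k | ∃ X, IsInducedMatching G X k}

/-- An independent triangle packing with `k` triangles: pairwise disjoint
triangles with no edges of `G` between different triangles. -/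
def IsIndepTrianglePacking (k : ℕ) (f : Fin k → Set V) : Prop :=
  (∀ i, ∃ a b c : V, f i = {a, b, c} ∧ G.Adj a b ∧ G.Adj a c ∧ G.Adj b c) ∧
  (∀ i j, i ≠ j → ∀ u ∈ f i, ∀ v ∈ f j, u ≠ v ∧ ¬ G.Adj u v)

/-- The maximum number of triangles in an independent triangle packing of `G`. -/
noncomputable def itpNum : ℕ :=
  sSup {k | ∃ f : Fin k → Set V, IsIndepTrianglePacking G k f}

/-- `C` is the vertex set of an induced cycle of `G`. -/
def IsCycleSet (C : Set V) : Prop :=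
  3 ≤ C.ncard ∧ (G.induce C).Connected ∧ ∀ v ∈ C, {u | u ∈ C ∧ G.Adj v u}.ncard = 2

/-- An independent cycle packing with `k` cycles: pairwise disjoint induced
cycles with no edges of `G` between different cycles. -/
def IsIndepCyclePacking (k : ℕ) (f : Fin k → Set V) : Prop :=
  (∀ i, IsCycleSet G (f i)) ∧
  (∀ i j, i ≠ j → ∀ u ∈ f i, ∀ v ∈ f j, u ≠ v ∧ ¬ G.Adj u v)

/-- The maximum number of cycles in an independent cycle packing of `G`. -/
noncomputable def icpNum : ℕ :=
  sSup {k | ∃ f : Fin k → Set V, IsIndepCyclePacking G k f}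

end Invariants

theorem SimpleGraph.IsModuleSet.preimage {U V : Type*} {G : SimpleGraph V} {P : SimpleGraph U}
    {M : Set V} (hM : G.IsModuleSet M) (f : P ↪g G) : P.IsModuleSet (f ⁻¹' M) := by
  intro v hv
  refine (hM (f v) hv).imp (fun h m hm => ?_) (fun h m hm => ?_)
  · exact f.map_adj_iff.1 (h _ hm)
  · exact fun hvm => h _ hm (f.map_adj_iff.2 hvm)

/-- Paths on at least four vertices are prime graphs. -/
theorem SimpleGraph.IsModuleSet.pathGraph_trivial {n : ℕ} (hn : 4 ≤ n) {X : Set (Fin n)}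
    (hX : (pathGraph n).IsModuleSet X) : X.Subsingleton ∨ X = Set.univ := by
  by_contra! ⟨hsub, huniv⟩
  obtain ⟨a, ha, b, hb, hab⟩ := hsub
  obtain ⟨c, hc⟩ := (Set.ne_univ_iff_exists_notMem X).1 huniv
  obtain ⟨p⟩ := pathGraph_preconnected n a c
  obtain ⟨d, -, hd1, hd2⟩ := p.exists_boundary_dart X ha hc
  have hall : ∀ m ∈ X, (pathGraph n).Adj d.snd m :=
    (hX d.snd hd2).resolve_right fun h => h _ hd1 d.adj.symm
  have key : ∀ i j k : Fin n, i ∈ X → k ∈ X → i.val + 1 = j.val → j.val + 1 = k.val →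
      (∀ m ∈ X, m = i ∨ m = k) → False := by
    intro i j k hi hk hij hjk hm
    by_cases hlt : k.val + 1 < n
    · have hnot : (⟨k.val + 1, hlt⟩ : Fin n) ∉ X := by
        intro h
        rcases hm _ h with h | h <;> simp only [Fin.ext_iff] at h <;> omega
      rcases hX _ hnot with h | h
      · have := h i hi
        simp only [pathGraph_adj] at this
        omega
      · exact h k hk (by simp [pathGraph_adj])
    · have hlt' : i.val - 1 < n := by omega
      have hnot : (⟨i.val - 1, hlt'⟩ : Fin n) ∉ X := by
        intro h
        rcases hm _ h with h | h <;> simp only [Fin.ext_iff] at h <;> omega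
      rcases hX _ hnot with h | h
      · have := h k hk
        simp only [pathGraph_adj] at this
        omega
      · refine h i hi ?_
        simp only [pathGraph_adj]
        omega
  have hm : ∀ m ∈ X, m = a ∨ m = b := by
    intro m hm
    have h1 := hall m hm
    have h2 := hall a ha
    have h3 := hall b hb
    simp only [pathGraph_adj, Fin.ext_iff, ne_eq] at *
    omega
  have h2 := hall a ha
  have h3 := hall b hb
  simp only [pathGraph_adj] at h2 h3
  rw [ne_eq, Fin.ext_iff] at hab
  rcases h2 with h2 | h2
  · exact key b d.snd a hb ha (by omega) (by omega) fun m h => (hm m h).symm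
  · exact key a d.snd b ha hb (by omega) (by omega) hm

theorem le_card_of_mem_lip {V : Type*} [Finite V] (G : SimpleGraph V) :
    Nat.card V ∈ upperBounds {n | ∃ S : Set V, Nonempty (G.induce S ≃g pathGraph n)} := by
  rintro n ⟨S, ⟨e⟩⟩
  simpa using Nat.card_le_card_of_injective _
    (Subtype.val_injective.comp e.symm.injective : Function.Injective fun i => (e.symm i).1)

theorem le_lipNum {V : Type*} [Finite V] {G : SimpleGraph V} {n : ℕ} (f : pathGraph n ↪g G) :
    n ≤ lipNum G :=
  le_csSup ⟨_, le_card_of_mem_lip G⟩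
    ⟨Set.range f, ⟨⟨(Equiv.ofInjective f f.injective).symm, by
      rintro ⟨_, i, rfl⟩ ⟨_, j, rfl⟩
      simp [Equiv.ofInjective_symm_apply, f.map_adj_iff]⟩⟩⟩

theorem exists_pathGraph_lipNum_embedding {V : Type*} [Finite V] (G : SimpleGraph V) :
    Nonempty (pathGraph (lipNum G) ↪g G) := by
  obtain ⟨S, ⟨e⟩⟩ : lipNum G ∈ {n | ∃ S : Set V, Nonempty (G.induce S ≃g pathGraph n)} := by
    refine Nat.sSup_mem ⟨0, ∅, ⟨⟨Equiv.equivOfIsEmpty _ _, ?_⟩⟩⟩ ⟨_, le_card_of_mem_lip G⟩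
    exact fun {a} => isEmptyElim a
  exact ⟨(Embedding.induce S).comp e.symm.toEmbedding⟩

section ModularReplacement

variable {V W : Type*} {G : SimpleGraph V} {M : Set V} {H : SimpleGraph W}

@[simp]
theorem modularReplacement_adj_inl_inl (u v : {v : V // v ∉ M}) :
    (modularReplacement G M H).Adj (Sum.inl u) (Sum.inl v) ↔ G.Adj u.1 v.1 := by
  simp only [modularReplacement, fromRel_adj, ne_eq, Sum.inl.injEq, G.adj_comm v.1 u.1, or_self,
    and_iff_right_iff_imp]
  rintro h rfl
  exact h.ne rfl

@[simp]
theorem modularReplacement_adj_inr_inr (u v : W) :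
    (modularReplacement G M H).Adj (Sum.inr u) (Sum.inr v) ↔ H.Adj u v := by
  simp only [modularReplacement, fromRel_adj, ne_eq, Sum.inr.injEq, H.adj_comm v u, or_self,
    and_iff_right_iff_imp]
  exact fun h => h.ne

@[simp]
theorem modularReplacement_adj_inl_inr (u : {v : V // v ∉ M}) (w : W) :
    (modularReplacement G M H).Adj (Sum.inl u) (Sum.inr w) ↔ ∃ m ∈ M, G.Adj u.1 m := by
  simp [modularReplacement]

theorem SimpleGraph.IsModuleSet.exists_adj_iff (hM : G.IsModuleSet M) {v m : V} (hv : v ∉ M)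
    (hm : m ∈ M) : (∃ x ∈ M, G.Adj v x) ↔ G.Adj v m := by
  refine ⟨fun ⟨x, hx, hvx⟩ => ?_, fun h => ⟨m, hm, h⟩⟩
  exact (hM v hv).resolve_right (fun h => h x hx hvx) m hm

/-- An induced subgraph of `G` that meets the module in at most one vertex is also an induced
subgraph of the modular replacement. -/
theorem exists_embedding_modularReplacement {U : Type*} {P : SimpleGraph U} [Nonempty W]
    (hM : G.IsModuleSet M) (f : P ↪g G) (hf : (f ⁻¹' M).Subsingleton) :
    Nonempty (P ↪g modularReplacement G M H) := by
  classical
  obtain ⟨w⟩ := ‹Nonempty W›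
  let g : U → {v : V // v ∉ M} ⊕ W := fun i =>
    if h : f i ∈ M then Sum.inr w else Sum.inl ⟨f i, h⟩
  have g_mem : ∀ {i}, f i ∈ M → g i = Sum.inr w := fun h => dif_pos h
  have g_notMem : ∀ {i} (h : f i ∉ M), g i = Sum.inl ⟨f i, h⟩ := fun h => dif_neg h
  refine ⟨⟨⟨g, fun i j hij => ?_⟩, fun {i j} => ?_⟩⟩
  · by_cases hi : f i ∈ M <;> by_cases hj : f j ∈ M
    · exact hf hi hj
    · simp [g_mem hi, g_notMem hj] at hij
    · simp [g_notMem hi, g_mem hj] at hij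
    · simpa [g_notMem hi, g_notMem hj] using hij
  · change (modularReplacement G M H).Adj (g i) (g j) ↔ P.Adj i j
    by_cases hi : f i ∈ M <;> by_cases hj : f j ∈ M
    · obtain rfl := hf hi hj
      simp
    · rw [g_mem hi, g_notMem hj, adj_comm, modularReplacement_adj_inl_inr,
        hM.exists_adj_iff hj hi, f.map_adj_iff, adj_comm]
    · rw [g_notMem hi, g_mem hj, modularReplacement_adj_inl_inr, hM.exists_adj_iff hi hj,
        f.map_adj_iff]
    · rw [g_notMem hi, g_notMem hj, modularReplacement_adj_inl_inl, f.map_adj_iff]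

/-- The replacing graph as an induced subgraph of the modular replacement. -/
def modularReplacementInr (G : SimpleGraph V) (M : Set V) (H : SimpleGraph W) :
    H ↪g modularReplacement G M H :=
  ⟨⟨Sum.inr, Sum.inr_injective⟩, modularReplacement_adj_inr_inr _ _⟩

end ModularReplacement

theorem stmt16 {V W : Type*} [Fintype V] [Fintype W]
    (G : SimpleGraph V) (H : SimpleGraph W) (M : Set V)
    (hG : G.Connected) (hH : H.Connected)
    (hMod : G.IsModuleSet M) (hne : M.Nonempty) (hproper : M ≠ Set.univ)
    (hlong : 4 ≤ lipNum G)
    (hlip : lipNum (G.induce M) = lipNum H) :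
    lipNum G ≤ lipNum (modularReplacement G M H) := by
  have := hH.nonempty
  obtain ⟨f⟩ := exists_pathGraph_lipNum_embedding G
  rcases (hMod.preimage f).pathGraph_trivial hlong with hf | hf
  · obtain ⟨g⟩ := exists_embedding_modularReplacement (H := H) hMod f hf
    exact le_lipNum g
  · have hmem : ∀ i, f i ∈ M := Set.eq_univ_iff_forall.1 hf
    let f' : pathGraph (lipNum G) ↪g G.induce M :=
      ⟨⟨fun i => ⟨f i, hmem i⟩, fun i j h => f.injective (congrArg Subtype.val h)⟩,
        f.map_adj_iff⟩
    obtain ⟨h⟩ := exists_pathGraph_lipNum_embedding H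
    calc lipNum G ≤ lipNum (G.induce M) := le_lipNum f'
      _ = lipNum H := hlip
      _ ≤ _ := le_lipNum ((modularReplacementInr G M H).comp h)
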